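/- Let n ≥ 2 be a natural number and let ε be a real number with 0 < ε ≤ 1/3. Let M be a finite type, enc : (Fin n → Fin n) → M, and dec : M → (Fin n → Fin n). If, for f sampled uniformly from the functions Fin n → Fin n and j sampled uniformly from Fin n, the probability that dec(enc f)(j) ≠ f(j) is strictly less than ε, then |M| > 2^{(1 − 3ε)·n·log₂ n}. -/

import Mathlib

/-- Weighted count of the words at each Hamming distance from a fixed word `g`. -/
theorem sum_pow_hammingDist {n : ℕ} (g : Fin n → Fin n) (t : ℝ) :
    ∑ f : Fin n → Fin n, t ^ hammingDist g f = (1 + ((n : ℝ) - 1) * t) ^ n := by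
  have hterm (f : Fin n → Fin n) :
      t ^ hammingDist g f = ∏ j, if g j ≠ f j then t else 1 := by
    rw [Finset.prod_ite, Finset.prod_const, Finset.prod_const_one, mul_one, hammingDist]
  have hfactor (j : Fin n) :
      ∑ y : Fin n, (if g j ≠ y then t else 1) = 1 + ((n : ℝ) - 1) * t := by
    have hsplit (y : Fin n) :
        (if g j ≠ y then t else 1) = t + if g j = y then 1 - t else 0 := by
      by_cases h : g j = y <;> simp [h]
    simp only [hsplit, Finset.sum_add_distrib, Finset.sum_ite_eq, Finset.mem_univ, if_true,
      Finset.sum_const, Finset.card_univ, Fintype.card_fin, nsmul_eq_mul]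
    ring
  calc ∑ f : Fin n → Fin n, t ^ hammingDist g f
      = ∑ f : Fin n → Fin n, ∏ j, (if g j ≠ f j then t else 1) :=
        Finset.sum_congr rfl fun f _ => hterm f
    _ = ∏ j : Fin n, ∑ y : Fin n, (if g j ≠ y then t else 1) := by
        rw [Finset.prod_univ_sum, Fintype.piFinset_univ]
    _ = (1 + ((n : ℝ) - 1) * t) ^ n := by
        simp only [hfactor, Finset.prod_const, Finset.card_univ, Fintype.card_fin]

/-- The generating function of the decoding distance is at most the number of messages times
the generating function of a single Hamming space. -/
theorem sum_pow_hammingDist_decode_le {n : ℕ} {M : Type*} [Fintype M]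
    (enc : (Fin n → Fin n) → M) (dec : M → (Fin n → Fin n)) {t : ℝ} (ht : 0 ≤ t) :
    ∑ f, t ^ hammingDist (dec (enc f)) f ≤
      (Fintype.card M : ℝ) * (1 + ((n : ℝ) - 1) * t) ^ n := by
  calc ∑ f, t ^ hammingDist (dec (enc f)) f
      ≤ ∑ f, ∑ m, t ^ hammingDist (dec m) f :=
        Finset.sum_le_sum fun f _ =>
          Finset.single_le_sum (f := fun m => t ^ hammingDist (dec m) f)
            (fun m _ => pow_nonneg ht _) (Finset.mem_univ (enc f))
    _ = (Fintype.card M : ℝ) * (1 + ((n : ℝ) - 1) * t) ^ n := by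
        rw [Finset.sum_comm]
        simp [sum_pow_hammingDist]

theorem card_decoding_errors {n : ℕ} {M : Type*}
    (enc : (Fin n → Fin n) → M) (dec : M → (Fin n → Fin n)) :
    (Finset.univ.filter fun q : (Fin n → Fin n) × Fin n =>
      dec (enc q.1) q.2 ≠ q.1 q.2).card = ∑ f, hammingDist (dec (enc f)) f := by
  simp only [Finset.card_filter, hammingDist, Fintype.sum_prod_type]

/-- The exponential function `a ↦ t ^ a` lies above its tangents. -/
theorem rpow_tangent_le_pow {t : ℝ} (ht : 0 < t) (a : ℝ) (d : ℕ) :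
    t ^ a * (1 + ((d : ℝ) - a) * Real.log t) ≤ t ^ d := by
  have h : t ^ d = t ^ a * t ^ ((d : ℝ) - a) := by
    rw [← Real.rpow_add ht, ← Real.rpow_natCast]
    ring_nf
  rw [h]
  refine mul_le_mul_of_nonneg_left ?_ (Real.rpow_nonneg ht.le _)
  rw [Real.rpow_def_of_pos ht]
  linarith [Real.add_one_le_exp (Real.log t * ((d : ℝ) - a))]

/-- Strict Jensen inequality for `a ↦ t ^ a` with a strict bound on the mean exponent. -/
theorem card_mul_rpow_lt_sum_pow {ι : Type*} [Fintype ι] (d : ι → ℕ) {t a : ℝ}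
    (ht0 : 0 < t) (ht1 : t < 1) (hd : ∑ i, (d i : ℝ) < a * Fintype.card ι) :
    (Fintype.card ι : ℝ) * t ^ a < ∑ i, t ^ d i := by
  have hsum : ∑ i, t ^ a * (1 + ((d i : ℝ) - a) * Real.log t) ≤ ∑ i, t ^ d i :=
    Finset.sum_le_sum fun i _ => rpow_tangent_le_pow ht0 a (d i)
  refine lt_of_lt_of_le ?_ hsum
  rw [← Finset.mul_sum, Finset.sum_add_distrib, ← Finset.sum_mul, Finset.sum_sub_distrib]
  simp only [Finset.sum_const, Finset.card_univ, nsmul_eq_mul, mul_one]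
  have hlog := Real.log_neg ht0 ht1
  have hpos := Real.rpow_pos_of_pos ht0 a
  have hmul := mul_pos_of_neg_of_neg
    (show ∑ i, (d i : ℝ) - Fintype.card ι * a < 0 by linarith) hlog
  nlinarith

theorem one_add_pow_three_mul_le_sq {n : ℕ} (hn : 2 ≤ n) :
    (1 + ((n : ℝ) - 1) * ((n : ℝ) ^ 2)⁻¹) ^ (3 * n) ≤ (n : ℝ) ^ 2 := by
  by_cases h5 : 5 ≤ n
  · have hn0 : (0 : ℝ) < n := by positivity
    have hn5 : (5 : ℝ) ≤ n := by exact_mod_cast h5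
    have hle : 1 + ((n : ℝ) - 1) * ((n : ℝ) ^ 2)⁻¹ ≤ Real.exp ((n : ℝ)⁻¹) := by
      have h1 : ((n : ℝ) - 1) * ((n : ℝ) ^ 2)⁻¹ ≤ (n : ℝ)⁻¹ := by
        have : (n : ℝ)⁻¹ = n * ((n : ℝ) ^ 2)⁻¹ := by field_simp
        rw [this]
        gcongr
        linarith
      linarith [Real.add_one_le_exp ((n : ℝ)⁻¹)]
    have hbase : 0 ≤ 1 + ((n : ℝ) - 1) * ((n : ℝ) ^ 2)⁻¹ := by
      have : (0 : ℝ) ≤ n - 1 := by linarith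
      positivity
    calc (1 + ((n : ℝ) - 1) * ((n : ℝ) ^ 2)⁻¹) ^ (3 * n)
        ≤ Real.exp ((n : ℝ)⁻¹) ^ (3 * n) := pow_le_pow_left₀ hbase hle _
      _ = Real.exp 1 ^ 3 := by
          rw [← Real.exp_nat_mul, ← Real.exp_nat_mul]
          congr 1
          push_cast
          field_simp
      _ ≤ 2.7182818286 ^ 3 := by
          gcongr
          exact Real.exp_one_lt_d9.le
      _ ≤ 5 ^ 2 := by norm_num
      _ ≤ (n : ℝ) ^ 2 := by gcongr
  · interval_cases n <;> norm_num

theorem one_add_pow_le_rpow {n : ℕ} (hn : 2 ≤ n) {x : ℝ} (hx : 2 / 3 ≤ x) :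
    (1 + ((n : ℝ) - 1) * ((n : ℝ) ^ 2)⁻¹) ^ n ≤ (n : ℝ) ^ x := by
  have hn1 : (1 : ℝ) ≤ n := by exact_mod_cast (by omega : 1 ≤ n)
  have hcube : ((1 + ((n : ℝ) - 1) * ((n : ℝ) ^ 2)⁻¹) ^ n) ^ 3 ≤ ((n : ℝ) ^ (2 / 3 : ℝ)) ^ 3 := by
    have : ((n : ℝ) ^ (2 / 3 : ℝ)) ^ 3 = (n : ℝ) ^ 2 := by
      rw [← Real.rpow_natCast, ← Real.rpow_mul (by positivity)]
      norm_num
    rw [this, ← pow_mul, mul_comm n 3]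
    exact one_add_pow_three_mul_le_sq hn
  exact (le_of_pow_le_pow_left₀ three_ne_zero (by positivity) hcube).trans
    (Real.rpow_le_rpow_of_exponent_le hn1 hx)

theorem rpow_neg_three_mul_le {n : ℕ} (hn : 2 ≤ n) {x : ℝ} (hx0 : 0 ≤ x) (hx : x ≤ 2 / 3) :
    (n : ℝ) ^ (-(3 * x)) ≤ 1 - x := by
  have hn2 : (2 : ℝ) ≤ n := by exact_mod_cast hn
  have hinv : ((n : ℝ) ^ 2)⁻¹ ≤ 1 / 4 := by
    rw [inv_le_comm₀ (by positivity) (by norm_num)]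
    norm_num
    nlinarith
  have hrw : (n : ℝ) ^ (-(3 * x)) = (1 + (((n : ℝ) ^ 2)⁻¹ - 1)) ^ (3 * x / 2) := by
    rw [add_sub_cancel, ← Real.rpow_natCast, ← Real.rpow_neg (by positivity),
      ← Real.rpow_mul (by positivity)]
    congr 1
    push_cast
    ring
  have hpos : 0 ≤ ((n : ℝ) ^ 2)⁻¹ := by positivity
  rw [hrw]
  refine (rpow_one_add_le_one_add_mul_self (by linarith) (by linarith) (by linarith)).trans ?_
  nlinarith

/-- Strong width lower bound: if the error probability of decoding a uniformly
random function `f : Fin n → Fin n` at a uniformly random point is below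
`ε ≤ 1/3`, then the message space must have more than
`2 ^ ((1 − 3ε)·n·log₂ n)` elements. -/
theorem message_space_lower_bound
    (n : ℕ) (hn : 2 ≤ n) (ε : ℝ) (hε0 : 0 < ε) (hε1 : ε ≤ 1 / 3)
    (M : Type*) [Fintype M]
    (enc : (Fin n → Fin n) → M) (dec : M → (Fin n → Fin n))
    (herr :
      ((Finset.univ.filter fun q : (Fin n → Fin n) × Fin n =>
          dec (enc q.1) q.2 ≠ q.1 q.2).card : ℝ) /
        (Fintype.card ((Fin n → Fin n) × Fin n) : ℝ) < ε) :
    (2 : ℝ) ^ ((1 - 3 * ε) * (n : ℝ) * Real.logb 2 n) < (Fintype.card M : ℝ) := by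
  have hn2 : (2 : ℝ) ≤ n := by exact_mod_cast hn
  have hn0 : (0 : ℝ) < n := by linarith
  have hcard : (Fintype.card (Fin n → Fin n) : ℝ) = (n : ℝ) ^ (n : ℝ) := by
    simp
  have hN : (0 : ℝ) < Fintype.card (Fin n → Fin n) := by rw [hcard]; positivity
  have hd : ∑ f, (hammingDist (dec (enc f)) f : ℝ) <
      n * ε * Fintype.card (Fin n → Fin n) := by
    rw [card_decoding_errors, Fintype.card_prod, Fintype.card_fin, Nat.cast_mul,
      div_lt_iff₀ (by positivity)] at herr
    push_cast at herr ⊢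
    linarith
  have hgoal : (2 : ℝ) ^ ((1 - 3 * ε) * (n : ℝ) * Real.logb 2 n) =
      (n : ℝ) ^ (n : ℝ) * (n : ℝ) ^ (-(3 * (n * ε))) := by
    rw [mul_comm, Real.rpow_mul (by norm_num), Real.rpow_logb (by norm_num) (by norm_num) hn0,
      ← Real.rpow_add hn0]
    ring_nf
  rw [hgoal, ← hcard]
  rcases le_total ((n : ℝ) * ε) (2 / 3) with hx | hx
  · have hexact := sum_pow_hammingDist_decode_le enc dec le_rfl
    have hbound : ∑ f, (1 - (hammingDist (dec (enc f)) f : ℝ)) ≤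
        ∑ f, (0 : ℝ) ^ hammingDist (dec (enc f)) f := by
      refine Finset.sum_le_sum fun f _ => ?_
      rcases Nat.eq_zero_or_pos (hammingDist (dec (enc f)) f) with h | h
      · simp [h]
      · have h1 : (1 : ℝ) ≤ hammingDist (dec (enc f)) f := by exact_mod_cast h
        rw [zero_pow h.ne']
        linarith
    rw [Finset.sum_sub_distrib, Finset.sum_const, Finset.card_univ, nsmul_eq_mul,
      mul_one] at hbound
    rw [mul_zero, add_zero, one_pow, mul_one] at hexact
    have hle := mul_le_mul_of_nonneg_left (rpow_neg_three_mul_le hn (by positivity) hx) hN.le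
    linarith
  · have ht1 : ((n : ℝ) ^ 2)⁻¹ < 1 := inv_lt_one_of_one_lt₀ (by nlinarith)
    have hlt := (card_mul_rpow_lt_sum_pow _ (by positivity) ht1 hd).trans_le
      (sum_pow_hammingDist_decode_le enc dec (by positivity))
    have hle := hlt.trans_le
      (mul_le_mul_of_nonneg_left (one_add_pow_le_rpow hn hx) (Nat.cast_nonneg _))
    have hpow : (((n : ℝ) ^ 2)⁻¹) ^ (n * ε) =
        (n : ℝ) ^ (-(3 * (n * ε))) * (n : ℝ) ^ (n * ε) := by
      rw [← Real.rpow_add hn0, ← Real.rpow_natCast, ← Real.rpow_neg hn0.le,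
        ← Real.rpow_mul hn0.le]
      congr 1
      push_cast
      ring
    rw [hpow, ← mul_assoc] at hle
    exact lt_of_mul_lt_mul_right hle (by positivity)
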